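/- Let F and G be distribution functions on ℝ with 1 − F(t) ~ L(t) t^{−r} and 1 − G(t) ~ L'(t) t^{−r'} as t → ∞, where L, L' are slowly varying and 0 < r < r'. Let ρ > 1 and let (a_n) be a sequence with a_n → ∞ and ρ^n (1 − F(a_n)) → 1. Then for every x > 0, ρ^n (1 − G(a_n x)) → 0 as n → ∞. -/

import Mathlib

open MeasureTheory Filter Set Topology

/-- A positive function is slowly varying if `L(λt)/L(t) → 1` as `t → ∞`, for every `λ > 0`. -/
def SlowlyVarying (L : ℝ → ℝ) : Prop :=
  ∀ lam : ℝ, 0 < lam → Tendsto (fun t => L (lam * t) / L t) atTop (𝓝 1)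

/-- If `f(t) ~ L(t) t^(-r)` with `L` slowly varying, then `f` is regularly varying of index `-r`. -/
theorem SlowlyVarying.tendsto_tail_ratio {f L : ℝ → ℝ} {r : ℝ} (hL : SlowlyVarying L)
    (hf : Tendsto (fun t : ℝ => f t / (L t * t ^ (-r))) atTop (𝓝 1)) {c : ℝ} (hc : 0 < c) :
    Tendsto (fun t => f (c * t) / f t) atTop (𝓝 (c ^ (-r))) := by
  have hscale : Tendsto (fun t : ℝ => c * t) atTop atTop := tendsto_id.const_mul_atTop hc
  have hfc := hf.comp hscale
  have hlim := (((hfc.div hf one_ne_zero).mul (hL c hc)).mul_const (c ^ (-r)))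
  simp only [div_one, one_mul] at hlim
  refine hlim.congr' ?_
  filter_upwards [hf.eventually_ne one_ne_zero, hfc.eventually_ne one_ne_zero,
    eventually_gt_atTop 0] with t ht htc ht0
  simp only [Function.comp_apply, Pi.div_apply, ne_eq, div_eq_zero_iff, mul_eq_zero, not_or]
    at ht htc ⊢
  obtain ⟨hft, hLt, htr⟩ := ht
  obtain ⟨-, hLct, -⟩ := htc
  have hcr : c ^ (-r) ≠ 0 := (Real.rpow_pos_of_pos hc _).ne'
  rw [Real.mul_rpow hc.le ht0.le]
  field_simp

/-- A function bounded on `[T, 2T]` that contracts by a factor `q < 1` whenever its argument is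
doubled tends to zero. -/
theorem tendsto_zero_of_doubling_contraction {h : ℝ → ℝ} {T M q : ℝ} (hT : 0 < T) (hM : 0 ≤ M)
    (hq0 : 0 ≤ q) (hq1 : q < 1) (hnonneg : ∀ t, T ≤ t → 0 ≤ h t)
    (hbase : ∀ t, T ≤ t → t ≤ 2 * T → h t ≤ M)
    (hstep : ∀ t, T ≤ t → h (2 * t) ≤ q * h t) :
    Tendsto h atTop (𝓝 0) := by
  have bounded_upto : ∀ n : ℕ, ∀ t, T ≤ t → t ≤ 2 ^ n * T → h t ≤ M := by
    intro n
    induction n with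
    | zero => intro t ht htn; exact hbase t ht (by linarith)
    | succ n ih =>
      intro t ht htn
      rcases le_total t (2 * T) with h2 | h2
      · exact hbase t ht h2
      · have hhalf := ih (t / 2) (by linarith) (by rw [pow_succ] at htn; linarith)
        have hdouble := hstep (t / 2) (by linarith)
        rw [mul_div_cancel₀ t two_ne_zero] at hdouble
        nlinarith
  have bounded : ∀ t, T ≤ t → h t ≤ M := by
    intro t ht
    obtain ⟨n, hn⟩ := pow_unbounded_of_one_lt (t / T) one_lt_two
    exact bounded_upto n t ht ((div_lt_iff₀ hT).1 hn).le
  have decay : ∀ k : ℕ, ∀ t, 2 ^ k * T ≤ t → h t ≤ M * q ^ k := by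
    intro k
    induction k with
    | zero => intro t ht; simpa using bounded t (by linarith)
    | succ k ih =>
      intro t ht
      have hpow : 2 ^ k * T ≤ t / 2 := by rw [pow_succ] at ht; linarith
      have hTt : T ≤ t / 2 :=
        (le_mul_of_one_le_left hT.le (one_le_pow₀ one_le_two)).trans hpow
      have hdouble := hstep (t / 2) hTt
      rw [mul_div_cancel₀ t two_ne_zero] at hdouble
      calc h t ≤ q * h (t / 2) := hdouble
        _ ≤ q * (M * q ^ k) := mul_le_mul_of_nonneg_left (ih _ hpow) hq0
        _ = M * q ^ (k + 1) := by ring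
  rw [Metric.tendsto_nhds]
  intro ε hε
  have hgeom : Tendsto (fun k : ℕ => M * q ^ k) atTop (𝓝 0) := by
    simpa using (tendsto_pow_atTop_nhds_zero_of_lt_one hq0 hq1).const_mul M
  obtain ⟨k, hk⟩ := (hgeom.eventually_lt_const hε).exists
  filter_upwards [eventually_ge_atTop (2 ^ k * T), eventually_ge_atTop T] with t htk htT
  rw [Real.dist_eq, sub_zero, abs_of_nonneg (hnonneg t htT)]
  exact (decay k t htk).trans_lt hk

/-- The quotient of two positive antitone functions whose doubling ratios tend to `β < α`
tends to zero. -/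
theorem Antitone.tendsto_div_zero_of_doubling_ratio {f g : ℝ → ℝ} {α β : ℝ}
    (hf : Antitone f) (hg : Antitone g)
    (hfpos : ∀ᶠ t in atTop, 0 < f t) (hgpos : ∀ᶠ t in atTop, 0 < g t)
    (hfr : Tendsto (fun t => f (2 * t) / f t) atTop (𝓝 α))
    (hgr : Tendsto (fun t => g (2 * t) / g t) atTop (𝓝 β)) (hβ : 0 ≤ β) (hβα : β < α) :
    Tendsto (fun t => g t / f t) atTop (𝓝 0) := by
  have hα : 0 < α := hβ.trans_lt hβα
  obtain ⟨q, hqβ, hq1⟩ := exists_between ((div_lt_one hα).2 hβα)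
  have hq0 : 0 ≤ q := (div_nonneg hβ hα.le).trans hqβ.le
  have hratio := (hgr.div hfr hα.ne').eventually_lt_const hqβ
  obtain ⟨T, hT⟩ := eventually_atTop.1
    (((hratio.and hfpos).and hgpos).and (eventually_gt_atTop 0))
  have hT0 : 0 < T := (hT T le_rfl).2
  have hfp : ∀ t, T ≤ t → 0 < f t := fun t ht => (hT t ht).1.1.2
  have hgp : ∀ t, T ≤ t → 0 < g t := fun t ht => (hT t ht).1.2
  have hf2T : 0 < f (2 * T) := hfp _ (by linarith)
  refine tendsto_zero_of_doubling_contraction (M := g T / f (2 * T)) hT0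
    (div_nonneg (hgp T le_rfl).le hf2T.le) hq0 hq1
    (fun t ht => (div_pos (hgp t ht) (hfp t ht)).le)
    (fun t ht ht2 => div_le_div₀ (hgp T le_rfl).le (hg ht) hf2T (hf ht2)) ?_
  intro t ht
  have hlt : g (2 * t) / g t / (f (2 * t) / f t) < q := (hT t ht).1.1.1
  have hft := hfp t ht
  have hgt := hgp t ht
  have hf2t : 0 < f (2 * t) := hfp _ (by linarith)
  calc g (2 * t) / f (2 * t)
      = g (2 * t) / g t / (f (2 * t) / f t) * (g t / f t) := by field_simp
    _ ≤ q * (g t / f t) := mul_le_mul_of_nonneg_right hlt.le (div_pos hgt hft).le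

/-- The tail `1 - F` of a monotone function with limit `1` is eventually positive if it is
asymptotically equivalent to some function. -/
theorem Monotone.eventually_tail_pos {F u : ℝ → ℝ} (hF : Monotone F)
    (hF1 : Tendsto F atTop (𝓝 1))
    (hu : Tendsto (fun t => (1 - F t) / u t) atTop (𝓝 1)) :
    ∀ᶠ t in atTop, 0 < 1 - F t := by
  filter_upwards [hu.eventually_ne one_ne_zero] with t ht
  exact lt_of_le_of_ne (sub_nonneg.2 (hF.ge_of_tendsto hF1 t)) fun h0 => ht (by simp [← h0])

/-- If `F`, `G` are distribution functions with regularly varying right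
tails of indices `0 < r < r'` respectively, `ρ > 1` and `a_n → ∞` with
`ρ^n (1 - F(a_n)) → 1`, then for every `x > 0`, `ρ^n (1 - G(a_n x)) → 0`: strictly lighter
regularly varying tails do not contribute under the normalization of the heaviest tail. -/
theorem statement16
    (F G L L' : ℝ → ℝ) (r r' ρ : ℝ) (hr : 0 < r) (hrr' : r < r')
    (hL : SlowlyVarying L) (hL' : SlowlyVarying L')
    (hFmono : Monotone F) (hF0 : Tendsto F atBot (𝓝 0)) (hF1 : Tendsto F atTop (𝓝 1))
    (hGmono : Monotone G) (hG0 : Tendsto G atBot (𝓝 0)) (hG1 : Tendsto G atTop (𝓝 1))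
    (htailF : Tendsto (fun t : ℝ => (1 - F t) / (L t * t ^ (-r))) atTop (𝓝 1))
    (htailG : Tendsto (fun t : ℝ => (1 - G t) / (L' t * t ^ (-r'))) atTop (𝓝 1))
    (hρ : 1 < ρ)
    (a : ℕ → ℝ) (hatop : Tendsto a atTop atTop)
    (ha : Tendsto (fun n => ρ ^ n * (1 - F (a n))) atTop (𝓝 1)) :
    ∀ x : ℝ, 0 < x →
      Tendsto (fun n => ρ ^ n * (1 - G (a n * x))) atTop (𝓝 0) := by
  intro x hx
  have hFpos := hFmono.eventually_tail_pos hF1 htailF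
  have hGpos := hGmono.eventually_tail_pos hG1 htailG
  have hquot : Tendsto (fun t => (1 - G t) / (1 - F t)) atTop (𝓝 0) :=
    Antitone.tendsto_div_zero_of_doubling_ratio (f := fun t => 1 - F t) (g := fun t => 1 - G t)
      (fun _ _ hst => sub_le_sub_left (hFmono hst) 1)
      (fun _ _ hst => sub_le_sub_left (hGmono hst) 1) hFpos hGpos
      (hL.tendsto_tail_ratio (f := fun t => 1 - F t) htailF two_pos)
      (hL'.tendsto_tail_ratio (f := fun t => 1 - G t) htailG two_pos)
      (Real.rpow_nonneg zero_le_two _)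
      (Real.rpow_lt_rpow_of_exponent_lt one_lt_two (neg_lt_neg hrr'))
  have hax : Tendsto (fun n => x * a n) atTop atTop := hatop.const_mul_atTop hx
  have hlim := (ha.mul ((hL.tendsto_tail_ratio (f := fun t => 1 - F t) htailF hx).comp
    hatop)).mul (hquot.comp hax)
  rw [mul_zero] at hlim
  refine hlim.congr' ?_
  filter_upwards [hatop.eventually hFpos, hax.eventually hFpos] with n hn hnx
  simp only [Function.comp_apply, mul_comm (a n) x]
  field_simp
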